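/- Let A_1, …, A_T ∈ ℝ^{n×n} be symmetric matrices whose eigenvalues all lie in [-1, 1], and suppose they share a common unit eigenvector v ∈ ℝ^n. Run Oja's algorithm: w_1 a unit vector in ℝ^n with vᵀ w_1 ≠ 0, z_t = w_t/‖w_t‖₂, w_{t+1} = (I + μ A_t) w_t, with step size μ ∈ (0, 1/2]. Then Σ_{t=1}^T ( vᵀ A_t v − z_tᵀ A_t z_t ) ≤ (3μ/2) Σ_{t=1}^T ‖A_t‖₂² − ln((vᵀ z_1)²)/(2μ). -/

import Mathlib

open Matrix

/-- The spectral norm (largest singular value) of a real square matrix, i.e. the operator norm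
of the induced linear map on Euclidean space. -/
noncomputable def specNorm {n : ℕ} (A : Matrix (Fin n) (Fin n) ℝ) : ℝ :=
  ‖Matrix.toEuclideanCLM (𝕜 := ℝ) A‖

theorem oja_log_aux (x : ℝ) (h1 : -(1/2) ≤ x) : x - x ^ 2 ≤ Real.log (1 + x) := by
  rcases le_total 0 x with h | h
  · have h2 := Real.one_sub_inv_le_log_of_pos (show 0 < 1 + x by linarith)
    refine le_trans ?_ h2
    have : 1 - (1 + x)⁻¹ = x / (1 + x) := by field_simp; ring
    rw [this, le_div_iff₀ (by linarith)]
    nlinarith [pow_nonneg h 3]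
  · obtain ⟨y, rfl⟩ : ∃ y, x = -y := ⟨-x, by ring⟩
    have hy0 : 0 ≤ y := by linarith
    have hy1 : y ≤ 1/2 := by linarith
    have h2 := Real.abs_log_sub_add_sum_range_le (x := y) (by rw [abs_of_nonneg hy0]; linarith) 4
    rw [abs_of_nonneg hy0] at h2
    have h3 := (abs_le.mp h2).1
    norm_num [Finset.sum_range_succ] at h3
    have h4 : y ^ 5 / (1 - y) ≤ 2 * y ^ 5 := by
      rw [div_le_iff₀ (by linarith)]
      nlinarith [pow_nonneg hy0 5]
    have h5 : 0 ≤ y ^ 2 * (1 / 2 - y / 3 - y ^ 2 / 4 - 2 * y ^ 3) := by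
      apply mul_nonneg (sq_nonneg y)
      have a : y ^ 2 ≤ 1 / 4 := by nlinarith
      have b : y ^ 3 ≤ 1 / 8 := by nlinarith
      nlinarith
    rw [← sub_eq_add_neg]
    nlinarith

theorem oja_step {n : ℕ} (μ : ℝ) (hμ0 : 0 < μ) (hμ : μ ≤ 1 / 2)
    (L : EuclideanSpace ℝ (Fin n) →L[ℝ] EuclideanSpace ℝ (Fin n))
    (v x y : EuclideanSpace ℝ (Fin n)) (hv : ‖v‖ = 1) (lam : ℝ) (hl : |lam| ≤ 1)
    (hLv : L v = lam • v) (hvx : inner ℝ v x ≠ 0)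
    (hsym : inner ℝ v (L x) = inner ℝ (L v) x) (hy : y = x + μ • L x) :
    inner ℝ v y ≠ 0 ∧ Real.log (‖y‖ ^ 2) - Real.log ((inner ℝ v y) ^ 2)
      ≤ Real.log (‖x‖ ^ 2) - Real.log ((inner ℝ v x) ^ 2)
        + 2 * μ * (inner ℝ (‖x‖⁻¹ • x) (L (‖x‖⁻¹ • x)) - lam) + 3 * μ ^ 2 * ‖L‖ ^ 2 := by
  have hx : x ≠ 0 := by rintro rfl; simp at hvx
  have hxn : 0 < ‖x‖ := norm_pos_iff.mpr hx
  have hls : |lam| ≤ ‖L‖ := by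
    have := L.le_opNorm v
    rwa [hLv, norm_smul, hv, mul_one, mul_one, Real.norm_eq_abs] at this
  have hl2 : lam ^ 2 ≤ ‖L‖ ^ 2 := by
    rw [← sq_abs lam]; gcongr
  have hml : -(1/2) ≤ μ * lam := by nlinarith [(abs_le.mp hl).1]
  have hvy : inner ℝ v y = (1 + μ * lam) * inner ℝ v x := by
    rw [hy, inner_add_right, inner_smul_right, hsym, hLv, real_inner_smul_left]; ring
  have hvy0 : inner ℝ v y ≠ 0 := by
    rw [hvy]; exact mul_ne_zero (by linarith) hvx
  refine ⟨hvy0, ?_⟩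
  have hy0 : y ≠ 0 := by intro h; simp [h] at hvy0
  have hyn : 0 < ‖y‖ := norm_pos_iff.mpr hy0
  have e1 : Real.log ((inner ℝ v y) ^ 2)
      = 2 * Real.log (1 + μ * lam) + Real.log ((inner ℝ v x) ^ 2) := by
    rw [hvy, mul_pow, Real.log_mul (pow_ne_zero 2 (by linarith)) (pow_ne_zero 2 hvx)]
    rw [Real.log_pow (1 + μ * lam)]; norm_num
  have e2 := oja_log_aux _ hml
  set q : ℝ := inner ℝ (‖x‖⁻¹ • x) (L (‖x‖⁻¹ • x)) with hq
  have hq' : inner ℝ x (L x) = ‖x‖ ^ 2 * q := by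
    rw [hq, map_smul, real_inner_smul_left, inner_smul_right]
    field_simp
  have hLx : ‖L x‖ ^ 2 ≤ ‖L‖ ^ 2 * ‖x‖ ^ 2 := by
    rw [← mul_pow]; gcongr; exact L.le_opNorm x
  have e3 : ‖y‖ ^ 2 ≤ ‖x‖ ^ 2 * (1 + (2 * μ * q + μ ^ 2 * ‖L‖ ^ 2)) := by
    rw [hy, norm_add_sq_real, inner_smul_right, hq', norm_smul, mul_pow, Real.norm_eq_abs, sq_abs]
    nlinarith [mul_le_mul_of_nonneg_left hLx (sq_nonneg μ)]
  have hpos : 0 < 1 + (2 * μ * q + μ ^ 2 * ‖L‖ ^ 2) := by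
    by_contra hc
    push Not at hc
    nlinarith [pow_pos hyn 2, mul_nonneg (sq_nonneg ‖x‖) (neg_nonneg.mpr hc)]
  have e4 : Real.log (‖y‖ ^ 2) ≤ Real.log (‖x‖ ^ 2) + (2 * μ * q + μ ^ 2 * ‖L‖ ^ 2) := by
    refine (Real.log_le_log (by positivity) e3).trans ?_
    rw [Real.log_mul (by positivity) hpos.ne']
    have := Real.log_le_sub_one_of_pos hpos
    linarith
  nlinarith [mul_le_mul_of_nonneg_left hl2 (sq_nonneg μ)]

theorem oja_dot {n : ℕ} (x y : EuclideanSpace ℝ (Fin n)) :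
    x ⬝ᵥ y = inner ℝ x y := by
  rw [EuclideanSpace.inner_eq_star_dotProduct, dotProduct_comm]; simp

theorem oja_clm {n : ℕ} (A : Matrix (Fin n) (Fin n) ℝ) (x : EuclideanSpace ℝ (Fin n)) :
    A.mulVec x = (Matrix.toEuclideanCLM (𝕜 := ℝ) A x : EuclideanSpace ℝ (Fin n)) := by
  simp

/-- **Regret bound for Oja's algorithm with a common unit eigenvector (Theorem 3).**
The matrices are symmetric with all eigenvalues in `[-1, 1]` and share the common unit
eigenvector `v`.  Indices are shifted so that round `t ∈ {1,…,T}` of the paper corresponds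
to `t ∈ {0,…,T-1}` here; in particular `w 0` is the initial unit vector `w_1` and
`z 0 = z_1 = w_1`. -/
theorem oja_regret_common_eigvec (n T : ℕ) (μ : ℝ) (hμ0 : 0 < μ) (hμ : μ ≤ 1 / 2)
    (A : ℕ → Matrix (Fin n) (Fin n) ℝ) (hA : ∀ t < T, (A t).IsSymm)
    (heigbound : ∀ t < T, ∀ (c : ℝ) (u : EuclideanSpace ℝ (Fin n)),
      u ≠ 0 → (A t).mulVec u = c • u → |c| ≤ 1)
    (v : EuclideanSpace ℝ (Fin n)) (hv : ‖v‖ = 1)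
    (heig : ∀ t < T, ∃ lam : ℝ, (A t).mulVec v = lam • v)
    (w : ℕ → EuclideanSpace ℝ (Fin n)) (hw1 : ‖w 0‖ = 1) (hinit : v ⬝ᵥ w 0 ≠ 0)
    (hrec : ∀ t, w (t + 1) = (1 + μ • A t).mulVec (w t))
    (z : ℕ → EuclideanSpace ℝ (Fin n)) (hz : ∀ t, z t = ‖w t‖⁻¹ • w t) :
    ∑ t ∈ Finset.range T, (v ⬝ᵥ (A t).mulVec v - z t ⬝ᵥ (A t).mulVec (z t))
      ≤ 3 * μ / 2 * ∑ t ∈ Finset.range T, specNorm (A t) ^ 2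
        - Real.log ((v ⬝ᵥ z 0) ^ 2) / (2 * μ) := by
  have hzz : ∀ t, z t ⬝ᵥ (A t).mulVec (z t)
      = inner ℝ (‖w t‖⁻¹ • w t) (Matrix.toEuclideanCLM (𝕜 := ℝ) (A t) (‖w t‖⁻¹ • w t)) := by
    intro t
    rw [oja_clm, oja_dot, hz]
  have hz0 : v ⬝ᵥ z 0 = inner ℝ v (w 0) := by
    rw [oja_dot, hz, hw1]; simp
  have key : ∀ k ≤ T, inner ℝ v (w k) ≠ 0 ∧
      Real.log (‖w k‖ ^ 2) - Real.log ((inner ℝ v (w k)) ^ 2)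
        ≤ - Real.log ((v ⬝ᵥ z 0) ^ 2) + 3 * μ ^ 2 * ∑ t ∈ Finset.range k, specNorm (A t) ^ 2
         - 2 * μ * ∑ t ∈ Finset.range k, (v ⬝ᵥ (A t).mulVec v - z t ⬝ᵥ (A t).mulVec (z t)) := by
    intro k
    induction k with
    | zero =>
      intro _
      refine ⟨by rwa [oja_dot] at hinit, ?_⟩
      rw [hz0, hw1]; simp
    | succ k ih =>
      intro hk
      have hkT : k < T := hk
      obtain ⟨h1, h2⟩ := ih hkT.le
      obtain ⟨lam, hlam⟩ := heig k hkT
      have hv0 : v ≠ 0 := by rintro rfl; simp at hv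
      have hl := heigbound k hkT lam v hv0 hlam
      have hLv : Matrix.toEuclideanCLM (𝕜 := ℝ) (A k) v = lam • v := by
        ext i
        have := congrFun hlam i
        simpa using this
      have hsym : inner ℝ v (Matrix.toEuclideanCLM (𝕜 := ℝ) (A k) (w k))
          = inner ℝ (Matrix.toEuclideanCLM (𝕜 := ℝ) (A k) v) (w k) := by
        rw [← oja_dot, ← oja_dot, ← oja_clm, ← oja_clm, dotProduct_mulVec,
          ← mulVec_transpose, (hA k hkT).eq]
      have hy : w (k + 1) = w k + μ • Matrix.toEuclideanCLM (𝕜 := ℝ) (A k) (w k) := by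
        ext i
        have := congrFun (hrec k) i
        simpa [add_mulVec, smul_mulVec] using this
      obtain ⟨g1, g2⟩ := oja_step μ hμ0 hμ _ v (w k) _ hv lam hl hLv h1 hsym hy
      refine ⟨g1, ?_⟩
      have hvv : v ⬝ᵥ (A k).mulVec v = lam := by
        rw [oja_clm, oja_dot, hLv, inner_smul_right, real_inner_self_eq_norm_sq, hv]; norm_num
      rw [Finset.sum_range_succ, Finset.sum_range_succ, hvv, hzz k]
      unfold specNorm at h2 ⊢
      linarith
  obtain ⟨h1, h2⟩ := key T le_rfl
  have h3 : Real.log ((inner ℝ v (w T)) ^ 2) ≤ Real.log (‖w T‖ ^ 2) := by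
    apply Real.log_le_log (by positivity)
    rw [← sq_abs]
    gcongr
    simpa [hv] using abs_real_inner_le_norm v (w T)
  have h4 : ∀ R S l : ℝ, 2 * μ * R ≤ 3 * μ ^ 2 * S - l → R ≤ 3 * μ / 2 * S - l / (2 * μ) := by
    intro R S l h
    have : 3 * μ / 2 * S - l / (2 * μ) = (3 * μ ^ 2 * S - l) / (2 * μ) := by
      field_simp
    rw [this, le_div_iff₀ (by linarith)]
    linarith
  apply h4
  linarith
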